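/- Let z : ℝ × [0,T) → ℂ \ {0} be a smooth solution of the equivariant flow (*), 2π-periodic and regular in φ for each t. Then f satisfies the evolution equation ∂_t f = Δf + ((n−1)/r)·⟨∇f, e_r⟩ + f·( k² + ((n−1)/r²)·(2⟨ν,e_r⟩² − 1) ), where ⟨∇f, e_r⟩ = (∂_φ f)(∂_φ r)/g. -/

import Mathlib

open Real Set

/-- Euclidean inner product on ℂ ≅ ℝ²: ⟨a,b⟩ = Re(conj a · b). -/
noncomputable def ip (a b : ℂ) : ℝ := a.re * b.re + a.im * b.im

/-- Outward unit normal ν = (∂_φ v − i ∂_φ u)/√g of a regular curve z = u + iv. -/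
noncomputable def nu (z : ℝ → ℂ) (φ : ℝ) : ℂ :=
  (‖deriv z φ‖)⁻¹ • (⟨(deriv z φ).im, -(deriv z φ).re⟩ : ℂ)

/-- Curvature k = (u'v'' − v'u'')/g^{3/2}. -/
noncomputable def curv (z : ℝ → ℂ) (φ : ℝ) : ℝ :=
  ((deriv z φ).re * (deriv (deriv z) φ).im -
    (deriv z φ).im * (deriv (deriv z) φ).re) / ‖deriv z φ‖ ^ 3

/-- f = k + (n−1)⟨z,ν⟩/|z|². -/
noncomputable def fq (n : ℕ) (z : ℝ → ℂ) (φ : ℝ) : ℝ :=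
  curv z φ + ((n : ℝ) - 1) * ip (z φ) (nu z φ) / ‖z φ‖ ^ 2

/-- Tangential Laplacian Δh = (1/√g)∂_φ(∂_φ h/√g) along the curve z. -/
noncomputable def lap (z : ℝ → ℂ) (h : ℝ → ℝ) (φ : ℝ) : ℝ :=
  (deriv (fun ψ => deriv h ψ / ‖deriv z ψ‖) φ) / ‖deriv z φ‖

/-- ⟨ν, e_r⟩ = ⟨z,ν⟩/|z|. -/
noncomputable def ner (z : ℝ → ℂ) (φ : ℝ) : ℝ := ip (z φ) (nu z φ) / ‖z φ‖

open scoped ContDiff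

section Schwarz

variable {E : Type*} [NormedAddCommGroup E] [NormedSpace ℝ E] {Z : ℝ → ℝ → E}

lemma hasDerivAt_slice_fst (h : Differentiable ℝ (fun p : ℝ × ℝ => Z p.1 p.2)) (t φ : ℝ) :
    HasDerivAt (fun s => Z s φ) (fderiv ℝ (fun p : ℝ × ℝ => Z p.1 p.2) (t, φ) (1, 0)) t :=
  (h (t, φ)).hasFDerivAt.comp_hasDerivAt (f := fun s : ℝ => (s, φ)) t
    ((hasDerivAt_id t).prodMk (hasDerivAt_const t φ))

lemma hasDerivAt_slice_snd (h : Differentiable ℝ (fun p : ℝ × ℝ => Z p.1 p.2)) (t φ : ℝ) :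
    HasDerivAt (Z t) (fderiv ℝ (fun p : ℝ × ℝ => Z p.1 p.2) (t, φ) (0, 1)) φ :=
  (h (t, φ)).hasFDerivAt.comp_hasDerivAt (f := fun ψ : ℝ => (t, ψ)) φ
    ((hasDerivAt_const φ t).prodMk (hasDerivAt_id φ))

lemma contDiff_deriv_snd (h : ContDiff ℝ ∞ (fun p : ℝ × ℝ => Z p.1 p.2)) :
    ContDiff ℝ ∞ (fun p : ℝ × ℝ => deriv (Z p.1) p.2) := by
  have hd := h.differentiable (by simp)
  simp_rw [fun p : ℝ × ℝ => (hasDerivAt_slice_snd hd p.1 p.2).deriv]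
  exact (h.fderiv_right (m := ∞) (by simp)).clm_apply contDiff_const

lemma hasDerivAt_deriv_slice (h : ContDiff ℝ ∞ (fun p : ℝ × ℝ => Z p.1 p.2)) (t φ : ℝ) :
    HasDerivAt (fun s => deriv (Z s) φ) (deriv (fun ψ => deriv (fun s => Z s ψ) t) φ) t := by
  have hd := h.differentiable (by simp)
  have hdd := (h.fderiv_right (m := ∞) (by simp)).differentiable (by simp)
  have hsymm : IsSymmSndFDerivAt ℝ (fun p : ℝ × ℝ => Z p.1 p.2) (t, φ) :=
    h.contDiffAt.isSymmSndFDerivAt (by simp; exact WithTop.coe_le_coe.2 le_top)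
  simp_rw [fun s => (hasDerivAt_slice_snd hd s φ).deriv,
    fun ψ => (hasDerivAt_slice_fst hd t ψ).deriv]
  have h₁ := (hasDerivAt_slice_fst
    (Z := fun s ψ => fderiv ℝ (fun p : ℝ × ℝ => Z p.1 p.2) (s, ψ)) hdd t φ).clm_apply
      (hasDerivAt_const t ((0, 1) : ℝ × ℝ))
  have h₂ := (hasDerivAt_slice_snd
    (Z := fun s ψ => fderiv ℝ (fun p : ℝ × ℝ => Z p.1 p.2) (s, ψ)) hdd t φ).clm_apply
      (hasDerivAt_const φ ((1, 0) : ℝ × ℝ))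
  rw [h₂.deriv]
  convert h₁ using 1
  simpa using hsymm (0, 1) (1, 0)

end Schwarz

lemma norm_sq_eq_re_im (w : ℂ) : ‖w‖ ^ 2 = w.re ^ 2 + w.im ^ 2 := by
  rw [← Complex.normSq_eq_norm_sq, Complex.normSq_apply]; ring

lemma HasDerivAt.complex_re {w : ℝ → ℂ} {w' : ℂ} {t : ℝ} (h : HasDerivAt w w' t) :
    HasDerivAt (fun s => (w s).re) w'.re t :=
  (Complex.reCLM.hasFDerivAt (x := w t)).comp_hasDerivAt t h

lemma HasDerivAt.complex_im {w : ℝ → ℂ} {w' : ℂ} {t : ℝ} (h : HasDerivAt w w' t) :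
    HasDerivAt (fun s => (w s).im) w'.im t :=
  (Complex.imCLM.hasFDerivAt (x := w t)).comp_hasDerivAt t h

lemma HasDerivAt.norm_ip {w : ℝ → ℂ} {w' : ℂ} {t : ℝ} (h : HasDerivAt w w' t) (h0 : w t ≠ 0) :
    HasDerivAt (fun s => ‖w s‖) (ip (w t) w' / ‖w t‖) t := by
  have h0' : ‖w t‖ ≠ 0 := norm_ne_zero_iff.2 h0
  have hs := ((h.complex_re.pow 2).add (h.complex_im.pow 2)).sqrt
    (by simpa [← norm_sq_eq_re_im] using h0')
  have he : (fun s => √((w s).re ^ 2 + (w s).im ^ 2)) = fun s => ‖w s‖ := by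
    funext s
    rw [← norm_sq_eq_re_im, Real.sqrt_sq (norm_nonneg _)]
  convert hs using 1
  · exact he.symm
  · simp only [Pi.add_apply, Pi.pow_apply]
    rw [← norm_sq_eq_re_im, Real.sqrt_sq (norm_nonneg _), ip]
    field_simp
    norm_num
    ring

/-- Derivative of the unit normal of a varying velocity vector. -/
lemma hasDerivAt_unit_normal {w : ℝ → ℂ} {w' : ℂ} {t : ℝ} (h : HasDerivAt w w' t)
    (h0 : w t ≠ 0) :
    HasDerivAt (fun s => (‖w s‖)⁻¹ • (⟨(w s).im, -(w s).re⟩ : ℂ))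
      ((((w t).re * w'.im - (w t).im * w'.re) / ‖w t‖ ^ 3) • w t) t := by
  have h0' : ‖w t‖ ≠ 0 := norm_ne_zero_iff.2 h0
  have hJ : HasDerivAt (fun s => (⟨(w s).im, -(w s).re⟩ : ℂ)) (⟨w'.im, -w'.re⟩ : ℂ) t := by
    have e (v : ℂ) : (⟨v.im, -v.re⟩ : ℂ) = -Complex.I * v := by apply Complex.ext <;> simp
    simpa only [e] using h.const_mul (-Complex.I)
  refine ((h.norm_ip h0).fun_inv h0' |>.smul hJ).congr_deriv ?_
  have hs := norm_sq_eq_re_im (w t)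
  apply Complex.ext <;> simp only [ip, Complex.add_re, Complex.add_im, Complex.smul_re,
    Complex.smul_im, smul_eq_mul] <;> field_simp
  · linear_combination w'.im * hs
  · linear_combination -w'.re * hs

section Curve

variable {p : ℝ → ℂ}

lemma hasDerivAt_deriv_of_contDiff {E : Type*} [NormedAddCommGroup E] [NormedSpace ℝ E]
    {g : ℝ → E} (hg : ContDiff ℝ ∞ g) (φ : ℝ) : HasDerivAt g (deriv g φ) φ :=
  (hg.differentiable (by simp) φ).hasDerivAt

/-- The Weingarten equation `∂_φ ν = k ∂_φ z`. -/
lemma hasDerivAt_nu (hp : ContDiff ℝ ∞ p) {φ : ℝ} (h0 : deriv p φ ≠ 0) :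
    HasDerivAt (nu p) (curv p φ • deriv p φ) φ :=
  hasDerivAt_unit_normal
    (hasDerivAt_deriv_of_contDiff (contDiff_infty_iff_deriv.1 hp).2 φ) h0

lemma contDiff_nu (hp : ContDiff ℝ ∞ p) (h0 : ∀ φ, deriv p φ ≠ 0) : ContDiff ℝ ∞ (nu p) := by
  have h1 := (contDiff_infty_iff_deriv.1 hp).2
  have hJ : ContDiff ℝ ∞ (fun φ => -Complex.I * deriv p φ) := contDiff_const.mul h1
  have : nu p = fun φ => (‖deriv p φ‖)⁻¹ • (-Complex.I * deriv p φ) := by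
    funext φ; unfold nu; congr 1; apply Complex.ext <;> simp
  rw [this]
  exact ((h1.norm ℝ h0).inv fun φ => norm_ne_zero_iff.2 (h0 φ)).smul hJ

lemma ContDiff.complex_re (hp : ContDiff ℝ ∞ p) : ContDiff ℝ ∞ (fun φ => (p φ).re) :=
  Complex.reCLM.contDiff.comp hp

lemma ContDiff.complex_im (hp : ContDiff ℝ ∞ p) : ContDiff ℝ ∞ (fun φ => (p φ).im) :=
  Complex.imCLM.contDiff.comp hp

lemma contDiff_curv (hp : ContDiff ℝ ∞ p) (h0 : ∀ φ, deriv p φ ≠ 0) :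
    ContDiff ℝ ∞ (curv p) := by
  have h1 := (contDiff_infty_iff_deriv.1 hp).2
  have h2 := (contDiff_infty_iff_deriv.1 h1).2
  exact ((h1.complex_re.mul h2.complex_im).sub (h1.complex_im.mul h2.complex_re)).div
    ((h1.norm ℝ h0).pow 3) fun φ => pow_ne_zero _ (norm_ne_zero_iff.2 (h0 φ))

lemma contDiff_fq (n : ℕ) (hp : ContDiff ℝ ∞ p) (h0 : ∀ φ, deriv p φ ≠ 0)
    (hz : ∀ φ, p φ ≠ 0) : ContDiff ℝ ∞ (fq n p) := by
  have hν := contDiff_nu hp h0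
  refine (contDiff_curv hp h0).add ((contDiff_const.mul ?_).div ((hp.norm ℝ hz).pow 2)
    fun φ => pow_ne_zero _ (norm_ne_zero_iff.2 (hz φ)))
  exact (hp.complex_re.mul hν.complex_re).add (hp.complex_im.mul hν.complex_im)

end Curve

section Variation

variable {w w₁ w₂ : ℝ → ℂ} {ν : ℂ} {t k F F₁ F₂ m : ℝ}

/-- The curvature under a normal variation of speed `-F`, where `w₁` and `w₂` are the first and
second derivatives of the curve at a fixed parameter, `F₁` and `F₂` are the derivatives of `F`
and `m` is the derivative of `F k`. -/
lemma hasDerivAt_curvature_of_normal_variation (h0 : w₁ t ≠ 0)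
    (hν : ν = (‖w₁ t‖)⁻¹ • (⟨(w₁ t).im, -(w₁ t).re⟩ : ℂ))
    (hk : k = ((w₁ t).re * (w₂ t).im - (w₁ t).im * (w₂ t).re) / ‖w₁ t‖ ^ 3)
    (h₁ : HasDerivAt w₁ (-(F₁ • ν) - (F * k) • w₁ t) t)
    (h₂ : HasDerivAt w₂ (-(F₂ • ν) - (F₁ * k) • w₁ t - (m • w₁ t + (F * k) • w₂ t)) t) :
    HasDerivAt (fun s => ((w₁ s).re * (w₂ s).im - (w₁ s).im * (w₂ s).re) / ‖w₁ s‖ ^ 3)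
      (F₂ / ‖w₁ t‖ ^ 2 - F₁ * (ip (w₁ t) (w₂ t) / ‖w₁ t‖) / ‖w₁ t‖ ^ 3 + F * k ^ 2) t := by
  have h0' : ‖w₁ t‖ ≠ 0 := norm_ne_zero_iff.2 h0
  have hs := norm_sq_eq_re_im (w₁ t)
  refine HasDerivAt.congr_deriv (((h₁.complex_re.mul h₂.complex_im).sub
    (h₁.complex_im.mul h₂.complex_re)).div
    ((h₁.norm_ip h0).pow 3) (pow_ne_zero _ h0')) ?_
  simp only [ip, hν, hk, Pi.mul_apply, Pi.sub_apply, Complex.add_re,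
    Complex.add_im, Complex.sub_re, Complex.sub_im, Complex.neg_re, Complex.neg_im,
    Complex.smul_re, Complex.smul_im, smul_eq_mul]
  generalize (w₁ t).re = a, (w₁ t).im = b, ‖w₁ t‖ = c, (w₂ t).re = d, (w₂ t).im = e at *
  field_simp
  grind

/-- The support function divided by `|z|²` under a normal variation of speed `-F`. -/
lemma hasDerivAt_support_of_normal_variation (h0 : w₁ t ≠ 0) (hz : w t ≠ 0)
    (hν : ν = (‖w₁ t‖)⁻¹ • (⟨(w₁ t).im, -(w₁ t).re⟩ : ℂ))
    (h : HasDerivAt w (-(F • ν)) t)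
    (h₁ : HasDerivAt w₁ (-(F₁ • ν) - (F * k) • w₁ t) t) :
    HasDerivAt (fun s => ip (w s) ((‖w₁ s‖)⁻¹ • (⟨(w₁ s).im, -(w₁ s).re⟩ : ℂ)) / ‖w s‖ ^ 2)
      (F₁ * ip (w t) (w₁ t) / ‖w₁ t‖ ^ 2 / ‖w t‖ ^ 2 +
        F / ‖w t‖ ^ 2 * (2 * (ip (w t) ν / ‖w t‖) ^ 2 - 1)) t := by
  have h0' : ‖w₁ t‖ ≠ 0 := norm_ne_zero_iff.2 h0
  have hz' : ‖w t‖ ≠ 0 := norm_ne_zero_iff.2 hz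
  have hs := norm_sq_eq_re_im (w₁ t)
  have hN := hasDerivAt_unit_normal h₁ h0
  refine HasDerivAt.congr_deriv (((h.complex_re.mul hN.complex_re).add
    (h.complex_im.mul hN.complex_im)).div
    ((h.norm_ip hz).pow 2) (pow_ne_zero _ hz')) ?_
  simp only [ip, hν, Pi.mul_apply, Pi.add_apply, Complex.sub_re, Complex.sub_im, Complex.neg_re,
    Complex.neg_im, Complex.smul_re, Complex.smul_im, smul_eq_mul]
  generalize (w₁ t).re = a, (w₁ t).im = b, ‖w₁ t‖ = c at *
  field_simp
  grind

end Variation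

/-- Evolution equation of f under the equivariant flow:
∂_t f = Δf + ((n−1)/r)⟨∇f,e_r⟩ + f(k² + ((n−1)/r²)(2⟨ν,e_r⟩² − 1)),
where ⟨∇f,e_r⟩ = (∂_φ f)(∂_φ r)/g. -/
theorem evolution_of_f (n : ℕ) (hn : 1 ≤ n) (T : ℝ) (z : ℝ → ℝ → ℂ)
    (hsm : ContDiff ℝ (⊤ : ℕ∞) (fun p : ℝ × ℝ => z p.1 p.2))
    (hper : ∀ t φ, z t (φ + 2 * π) = z t φ)
    (hreg : ∀ t ∈ Ico (0:ℝ) T, ∀ φ, deriv (z t) φ ≠ 0)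
    (hnz : ∀ t ∈ Ico (0:ℝ) T, ∀ φ, z t φ ≠ 0)
    (hflow : ∀ t ∈ Ico (0:ℝ) T, ∀ φ,
      deriv (fun s => z s φ) t = -(fq n (z t) φ) • nu (z t) φ) :
    ∀ t ∈ Ico (0:ℝ) T, ∀ φ : ℝ,
      deriv (fun s => fq n (z s) φ) t =
        lap (z t) (fq n (z t)) φ +
        ((n : ℝ) - 1) / ‖z t φ‖ *
          (deriv (fq n (z t)) φ * deriv (fun ψ => ‖z t ψ‖) φ / ‖deriv (z t) φ‖ ^ 2) +
        fq n (z t) φ * ((curv (z t) φ) ^ 2 +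
          ((n : ℝ) - 1) / ‖z t φ‖ ^ 2 * (2 * (ner (z t) φ) ^ 2 - 1)) := by
  intro t ht φ
  have hp : ContDiff ℝ ∞ (z t) := hsm.comp (contDiff_const.prodMk contDiff_id)
  have h0 := hreg t ht
  have hz := hnz t ht
  have hF := contDiff_fq n hp h0 hz
  have hF' := (contDiff_infty_iff_deriv.1 hF).2
  have hk := contDiff_curv hp h0
  have hp' := (contDiff_infty_iff_deriv.1 hp).2
  have dν := fun ψ => hasDerivAt_nu hp (h0 ψ)
  have hW : (fun ψ => deriv (fun s => z s ψ) t) = fun ψ => -(fq n (z t) ψ • nu (z t) ψ) := by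
    funext ψ; rw [hflow t ht ψ, neg_smul]
  have hW₁ : deriv (fun ψ => deriv (fun s => z s ψ) t) = fun ψ =>
      -(deriv (fq n (z t)) ψ • nu (z t) ψ) -
        (fq n (z t) ψ * curv (z t) ψ) • deriv (z t) ψ := by
    funext ψ
    rw [hW]
    refine ((hasDerivAt_deriv_of_contDiff hF ψ).smul (dν ψ)).neg.deriv.trans ?_
    rw [smul_smul]
    abel
  have hW₂ : deriv (deriv (fun ψ => deriv (fun s => z s ψ) t)) φ =
      -(deriv (deriv (fq n (z t))) φ • nu (z t) φ) -
        (deriv (fq n (z t)) φ * curv (z t) φ) • deriv (z t) φ -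
        (deriv (fun ψ => fq n (z t) ψ * curv (z t) ψ) φ • deriv (z t) φ +
          (fq n (z t) φ * curv (z t) φ) • deriv (deriv (z t)) φ) := by
    rw [hW₁]
    refine (((hasDerivAt_deriv_of_contDiff hF' φ).smul (dν φ)).neg.sub
      ((hasDerivAt_deriv_of_contDiff (hF.mul hk) φ).smul (hasDerivAt_deriv_of_contDiff hp' φ))).deriv.trans ?_
    rw [smul_smul]
    abel
  have v₀ : HasDerivAt (fun s => z s φ) (-(fq n (z t) φ • nu (z t) φ)) t := by
    rw [← congrFun hW φ]
    exact (hasDerivAt_slice_fst (hsm.differentiable (by simp)) t φ).differentiableAt.hasDerivAt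
  have v₁ := hasDerivAt_deriv_slice hsm t φ
  have v₂ := hasDerivAt_deriv_slice (Z := fun s => deriv (z s)) (contDiff_deriv_snd hsm) t φ
  simp_rw [fun ψ => (hasDerivAt_deriv_slice hsm t ψ).deriv] at v₂
  rw [hW₁] at v₁
  change HasDerivAt _ (deriv (deriv (fun ψ => deriv (fun s => z s ψ) t)) φ) t at v₂
  rw [hW₂] at v₂
  beta_reduce at v₁
  have dk := hasDerivAt_curvature_of_normal_variation (ν := nu (z t) φ) (k := curv (z t) φ)
    (w₁ := fun s => deriv (z s) φ) (w₂ := fun s => deriv (deriv (z s)) φ) (h0 φ) rfl rfl v₁ v₂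
  have ds := hasDerivAt_support_of_normal_variation (ν := nu (z t) φ) (k := curv (z t) φ)
    (w := fun s => z s φ) (w₁ := fun s => deriv (z s) φ) (h0 φ) (hz φ) rfl v₀ v₁
  have hnorm := (hasDerivAt_deriv_of_contDiff hp' φ).norm_ip (h0 φ)
  have hz' := norm_ne_zero_iff.2 (hz φ)
  have h0' := norm_ne_zero_iff.2 (h0 φ)
  have hlap : lap (z t) (fq n (z t)) φ = deriv (deriv (fq n (z t))) φ / ‖deriv (z t) φ‖ ^ 2 -
      deriv (fq n (z t)) φ * (ip (deriv (z t) φ) (deriv (deriv (z t)) φ) / ‖deriv (z t) φ‖) /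
        ‖deriv (z t) φ‖ ^ 3 := by
    rw [lap, ((hasDerivAt_deriv_of_contDiff hF' φ).fun_div hnorm h0').deriv]
    field_simp
  have hfq : deriv (fun s => fq n (z s) φ) t = _ :=
    ((dk.add (ds.const_mul ((n : ℝ) - 1))).congr_of_eventuallyEq (.of_forall fun s => by
      simp only [fq, mul_div_assoc]
      rfl)).deriv
  rw [hfq, hlap, ((hasDerivAt_deriv_of_contDiff hp φ).norm_ip (hz φ)).deriv, ner]
  field_simp
  ring
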